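/- Let X and Y be smooth real Banach spaces, and suppose dim X ≥ 3 or dim Y ≥ 3. Then there exists a Birkhoff–James orthogonality preserver T : X → Y if and only if X and Y are isometrically isomorphic (there exists a surjective linear isometry from X onto Y). -/

import Mathlib

/-- Birkhoff–James orthogonality: `x ⊥_BJ y` iff `‖x + λ y‖ ≥ ‖x‖` for all `λ : ℝ`. -/
def BJOrth {X : Type*} [NormedAddCommGroup X] [NormedSpace ℝ X] (x y : X) : Prop :=
  ∀ l : ℝ, ‖x‖ ≤ ‖x + l • y‖

/-- A normed space is smooth if the set of supporting functionals at every nonzero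
point is a singleton. -/
def SmoothSpace (X : Type*) [NormedAddCommGroup X] [NormedSpace ℝ X] : Prop :=
  ∀ x : X, x ≠ 0 → ∃ f : X →L[ℝ] ℝ, {g : X →L[ℝ] ℝ | ‖g‖ ≤ 1 ∧ g x = ‖x‖} = {f}


open Submodule

section Collineation

variable {E F : Type*} [AddCommGroup E] [Module ℝ E] [AddCommGroup F] [Module ℝ F]

/-- A surjection `T` preserving and reflecting membership in the span of two vectors, and mapping
the hyperplane `ker φ` to the hyperplane `ker ψ`, normalised at a vector `x₀` off `ker φ`. -/
structure HyperplaneCollineation (T : E → F) (φ : E →ₗ[ℝ] ℝ) (ψ : F →ₗ[ℝ] ℝ) (x₀ : E) : Prop where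
  surjective : Function.Surjective T
  mem_span_pair_iff : ∀ x y z, z ∈ span ℝ {x, y} ↔ T z ∈ span ℝ {T x, T y}
  apply_eq_zero_iff : ∀ x, φ x = 0 ↔ ψ (T x) = 0
  apply_base : φ x₀ = 1
  apply_image_base : ψ (T x₀) = 1
  exists_notMem_span : ∀ h, ∃ l, φ l = 0 ∧ l ∉ span ℝ {h}

/-- The map induced by `T` between the hyperplanes `ker φ` and `ker ψ`, identified with the affine
hyperplanes through `x₀` and `T x₀`. -/
noncomputable def affineChart (T : E → F) (ψ : F →ₗ[ℝ] ℝ) (x₀ h : E) : F :=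
  (ψ (T (x₀ + h)))⁻¹ • T (x₀ + h) - T x₀

namespace HyperplaneCollineation

variable {T : E → F} {φ : E →ₗ[ℝ] ℝ} {ψ : F →ₗ[ℝ] ℝ} {x₀ : E}

theorem mem_span_singleton_iff (hT : HyperplaneCollineation T φ ψ x₀) (x z : E) :
    z ∈ span ℝ {x} ↔ T z ∈ span ℝ {T x} := by
  simpa using hT.mem_span_pair_iff x x z

theorem map_zero (hT : HyperplaneCollineation T φ ψ x₀) : T 0 = 0 := by
  obtain ⟨w, hw⟩ := hT.surjective 0
  have h := (hT.mem_span_singleton_iff 0 w).2 (by rw [hw]; exact zero_mem _)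
  have hw0 : w = 0 := by simpa using h
  rwa [hw0] at hw

theorem apply_image_ne_zero (hT : HyperplaneCollineation T φ ψ x₀) {h : E} (hh : φ h = 0) :
    ψ (T (x₀ + h)) ≠ 0 := by
  rw [Ne, ← hT.apply_eq_zero_iff]
  simp [hh, hT.apply_base]

theorem apply_affineChart (hT : HyperplaneCollineation T φ ψ x₀) {h : E} (hh : φ h = 0) :
    ψ (affineChart T ψ x₀ h) = 0 := by
  simp [affineChart, hT.apply_image_base, inv_mul_cancel₀ (hT.apply_image_ne_zero hh)]

theorem affineChart_zero (hT : HyperplaneCollineation T φ ψ x₀) : affineChart T ψ x₀ 0 = 0 := by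
  simp [affineChart, hT.apply_image_base]

theorem exists_affineChart_add_eq_image (hT : HyperplaneCollineation T φ ψ x₀) {h k : E}
    (hh : φ h = 0) (hk : φ k = 0) :
    ∃ a : ℝ, affineChart T ψ x₀ (h + k) = affineChart T ψ x₀ h + a • T k := by
  have hmem : x₀ + (h + k) ∈ span ℝ {x₀ + h, k} :=
    mem_span_pair.2 ⟨1, 1, by module⟩
  obtain ⟨α, β, hαβ⟩ := mem_span_pair.1 ((hT.mem_span_pair_iff _ _ _).1 hmem)
  have hk' := (hT.apply_eq_zero_iff k).1 hk
  have h1 := hT.apply_image_ne_zero hh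
  have h2 : ψ (T (x₀ + (h + k))) ≠ 0 := hT.apply_image_ne_zero (by simp [hh, hk])
  have h3 : ψ (T (x₀ + (h + k))) = α * ψ (T (x₀ + h)) := by
    rw [← hαβ]; simp [hk']
  have hα : α ≠ 0 := by rintro rfl; simp [h3] at h2
  refine ⟨(ψ (T (x₀ + (h + k))))⁻¹ * β, ?_⟩
  have h4 : (ψ (T (x₀ + (h + k))))⁻¹ * α = (ψ (T (x₀ + h)))⁻¹ := by
    rw [h3]; field_simp
  unfold affineChart
  rw [← h4, ← hαβ]
  module

theorem exists_affineChart_eq_smul (hT : HyperplaneCollineation T φ ψ x₀) {h : E} (hh : φ h = 0) :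
    ∃ a : ℝ, affineChart T ψ x₀ h = a • T h := by
  simpa [hT.affineChart_zero] using hT.exists_affineChart_add_eq_image (h := 0) (by simp) hh

theorem affineChart_eq_zero (hT : HyperplaneCollineation T φ ψ x₀) {h : E} (hh : φ h = 0)
    (h0 : affineChart T ψ x₀ h = 0) : h = 0 := by
  have h1 : T (x₀ + h) ∈ span ℝ {T x₀} := by
    refine mem_span_singleton.2 ⟨ψ (T (x₀ + h)), ?_⟩
    rw [← sub_eq_zero.1 h0, smul_inv_smul₀ (hT.apply_image_ne_zero hh)]
  obtain ⟨c, hc⟩ := mem_span_singleton.1 ((hT.mem_span_singleton_iff _ _).2 h1)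
  have h2 : c = 1 := by
    have := congrArg φ hc
    simpa [hT.apply_base, hh] using this
  simpa [h2] using hc

theorem exists_image_eq_smul (hT : HyperplaneCollineation T φ ψ x₀) {h : E} (hh : φ h = 0) :
    ∃ b : ℝ, T h = b • affineChart T ψ x₀ h := by
  obtain ⟨a, ha⟩ := hT.exists_affineChart_eq_smul hh
  rcases eq_or_ne a 0 with rfl | ha0
  · have : h = 0 := hT.affineChart_eq_zero hh (by simpa using ha)
    exact ⟨0, by simp [this, hT.map_zero]⟩
  · exact ⟨a⁻¹, by rw [ha, inv_smul_smul₀ ha0]⟩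

theorem mem_span_of_affineChart (hT : HyperplaneCollineation T φ ψ x₀) {h k : E}
    (hh : φ h = 0) (hk : φ k = 0) {c : ℝ}
    (hc : affineChart T ψ x₀ k = c • affineChart T ψ x₀ h) : k ∈ span ℝ {h} := by
  obtain ⟨a, ha⟩ := hT.exists_affineChart_eq_smul hh
  obtain ⟨b, hb⟩ := hT.exists_image_eq_smul hk
  rw [hT.mem_span_singleton_iff, hb, hc, ha]
  exact smul_mem _ _ (smul_mem _ _ (smul_mem _ _ (mem_span_singleton_self _)))

theorem exists_affineChart_add_eq (hT : HyperplaneCollineation T φ ψ x₀) {h k : E}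
    (hh : φ h = 0) (hk : φ k = 0) :
    ∃ a : ℝ, affineChart T ψ x₀ (h + k) =
      affineChart T ψ x₀ h + a • affineChart T ψ x₀ k := by
  obtain ⟨a, ha⟩ := hT.exists_affineChart_add_eq_image hh hk
  obtain ⟨b, hb⟩ := hT.exists_image_eq_smul hk
  exact ⟨a * b, by rw [ha, mul_smul, ← hb]⟩

theorem affineChart_add_of_notMem (hT : HyperplaneCollineation T φ ψ x₀) {h k : E}
    (hh : φ h = 0) (hk : φ k = 0) (hhk : k ∉ span ℝ {h}) :
    affineChart T ψ x₀ (h + k) = affineChart T ψ x₀ h + affineChart T ψ x₀ k := by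
  obtain ⟨a, ha⟩ := hT.exists_affineChart_add_eq hh hk
  obtain ⟨b, hb⟩ := hT.exists_affineChart_add_eq hk hh
  rw [add_comm k h, ha] at hb
  have ha1 : a = 1 := by
    by_contra hne
    have hne' : a - 1 ≠ 0 := sub_ne_zero.2 hne
    refine hhk (hT.mem_span_of_affineChart hh hk (c := (a - 1)⁻¹ * (b - 1)) ?_)
    rw [mul_smul, eq_inv_smul_iff₀ hne']
    linear_combination (norm := module) hb
  rw [ha, ha1, one_smul]

theorem affineChart_add (hT : HyperplaneCollineation T φ ψ x₀) {h k : E}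
    (hh : φ h = 0) (hk : φ k = 0) :
    affineChart T ψ x₀ (h + k) = affineChart T ψ x₀ h + affineChart T ψ x₀ k := by
  by_cases hhk : k ∈ span ℝ {h}
  · obtain ⟨l, hl, hlh⟩ := hT.exists_notMem_span h
    have hsum : h + k ∈ span ℝ {h} := add_mem (mem_span_singleton_self _) hhk
    have h1 : l ∉ span ℝ {h + k} := fun hm => hlh ((span_singleton_le_iff_mem _ _).2 hsum hm)
    have h2 : l ∉ span ℝ {k} := fun hm => hlh ((span_singleton_le_iff_mem _ _).2 hhk hm)
    have h3 : k + l ∉ span ℝ {h} := fun hm => hlh (((span ℝ {h}).add_mem_iff_right hhk).1 hm)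
    have e1 := hT.affineChart_add_of_notMem (h := h + k) (by simp [hh, hk]) hl h1
    have e2 := hT.affineChart_add_of_notMem hk hl h2
    have e3 := hT.affineChart_add_of_notMem (k := k + l) hh (by simp [hl, hk]) h3
    rw [e2, ← add_assoc, e1, ← add_assoc] at e3
    exact add_right_cancel e3
  · exact hT.affineChart_add_of_notMem hh hk hhk

theorem exists_affineChart_smul (hT : HyperplaneCollineation T φ ψ x₀) {h : E}
    (hh : φ h = 0) (r : ℝ) :
    ∃ s : ℝ, affineChart T ψ x₀ (r • h) = s • affineChart T ψ x₀ h := by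
  obtain ⟨a, ha⟩ := hT.exists_affineChart_eq_smul (h := r • h) (by simp [hh])
  obtain ⟨b, hb⟩ := hT.exists_image_eq_smul hh
  obtain ⟨c, hc⟩ := mem_span_singleton.1 <| (hT.mem_span_singleton_iff h (r • h)).1 <|
    smul_mem _ _ (mem_span_singleton_self _)
  exact ⟨a * (c * b), by rw [ha, ← hc, hb, mul_smul, mul_smul]⟩

theorem affineChart_smul_of_notMem (hT : HyperplaneCollineation T φ ψ x₀) {h k : E}
    (hh : φ h = 0) (h0 : h ≠ 0) (hk : φ k = 0) (hhk : k ∉ span ℝ {h}) {r s : ℝ}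
    (hs : affineChart T ψ x₀ (r • h) = s • affineChart T ψ x₀ h) :
    affineChart T ψ x₀ (r • k) = s • affineChart T ψ x₀ k := by
  obtain ⟨t, ht⟩ := hT.exists_affineChart_smul hk r
  obtain ⟨u, hu⟩ := hT.exists_affineChart_smul (h := h + k) (by simp [hh, hk]) r
  rw [smul_add, hT.affineChart_add (by simp [hh]) (by simp [hk]), hT.affineChart_add hh hk,
    hs, ht] at hu
  have htu : t = u := by
    by_contra hne
    have hne' : t - u ≠ 0 := sub_ne_zero.2 hne
    refine hhk (hT.mem_span_of_affineChart hh hk (c := (t - u)⁻¹ * (u - s)) ?_)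
    rw [mul_smul, eq_inv_smul_iff₀ hne']
    linear_combination (norm := module) hu
  have hsu : (s - u) • affineChart T ψ x₀ h = 0 := by
    rw [htu] at hu
    linear_combination (norm := module) hu
  have hsu0 : s - u = 0 :=
    (smul_eq_zero.1 hsu).resolve_right fun hS => h0 (hT.affineChart_eq_zero hh hS)
  rw [ht, htu, sub_eq_zero.1 hsu0]

theorem affineChart_smul (hT : HyperplaneCollineation T φ ψ x₀) {h : E} (hh : φ h = 0) (r : ℝ) :
    affineChart T ψ x₀ (r • h) = r • affineChart T ψ x₀ h := by
  obtain ⟨e, he, he'⟩ := hT.exists_notMem_span 0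
  have he0 : e ≠ 0 := by rintro rfl; exact he' (zero_mem _)
  have hSe : affineChart T ψ x₀ e ≠ 0 := fun h0 => he0 (hT.affineChart_eq_zero he h0)
  choose σ hσ using hT.exists_affineChart_smul he
  have key : ∀ (r : ℝ) {k : E}, φ k = 0 →
      affineChart T ψ x₀ (r • k) = σ r • affineChart T ψ x₀ k := by
    intro r k hk
    by_cases hke : k ∈ span ℝ {e}
    · obtain ⟨l, hl, hle⟩ := hT.exists_notMem_span e
      have hkl : k + l ∉ span ℝ {e} := fun hm => hle (((span ℝ {e}).add_mem_iff_right hke).1 hm)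
      have e1 := hT.affineChart_smul_of_notMem he he0 hl hle (hσ r)
      have e2 := hT.affineChart_smul_of_notMem he he0 (by simp [hk, hl]) hkl (hσ r)
      rw [smul_add, hT.affineChart_add (by simp [hk]) (by simp [hl]), hT.affineChart_add hk hl,
        e1, smul_add] at e2
      exact add_right_cancel e2
    · exact hT.affineChart_smul_of_notMem he he0 hk hke (hσ r)
  have cancel : ∀ {a b : ℝ}, a • affineChart T ψ x₀ e = b • affineChart T ψ x₀ e → a = b :=
    fun hab => smul_left_injective ℝ hSe hab
  let f : ℝ →+* ℝ :=
    { toFun := σ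
      map_one' := cancel (by rw [← hσ]; simp)
      map_zero' := cancel (by rw [← hσ]; simp [hT.affineChart_zero])
      map_mul' := fun a b => cancel (by
        rw [← hσ, mul_smul, key a (by simp [he]), hσ, mul_smul])
      map_add' := fun a b => cancel (by
        rw [← hσ, add_smul, hT.affineChart_add (by simp [he]) (by simp [he]), hσ, hσ, add_smul]) }
  have hf : f = RingHom.id ℝ := Subsingleton.elim _ _
  rw [key r hh, show σ r = r from congrArg (fun g : ℝ →+* ℝ => g r) hf]

/-- The fundamental theorem of projective geometry for `HyperplaneCollineation`s. -/
theorem exists_linearEquiv (hT : HyperplaneCollineation T φ ψ x₀) :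
    ∃ A : E ≃ₗ[ℝ] F, ∀ x, ∃ c : ℝ, A x = c • T x := by
  have hproj : ∀ x, φ (x - φ x • x₀) = 0 := fun x => by simp [hT.apply_base]
  let A : E →ₗ[ℝ] F :=
    { toFun := fun x => φ x • T x₀ + affineChart T ψ x₀ (x - φ x • x₀)
      map_add' := fun x y => by
        rw [show x + y - φ (x + y) • x₀ = (x - φ x • x₀) + (y - φ y • x₀) by
          rw [map_add]; module, hT.affineChart_add (hproj x) (hproj y), map_add]
        module
      map_smul' := fun r x => by
        rw [show r • x - φ (r • x) • x₀ = r • (x - φ x • x₀) by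
          rw [map_smul, smul_eq_mul]; module, hT.affineChart_smul (hproj x), map_smul,
          smul_eq_mul, RingHom.id_apply]
        module }
  have hA : ∀ x, A x = φ x • T x₀ + affineChart T ψ x₀ (x - φ x • x₀) := fun _ => rfl
  have hA0 : ∀ x, A x = 0 → x = 0 := by
    intro x hx
    have hφ : φ x = 0 := by
      have := congrArg ψ hx
      simpa [hA, hT.apply_affineChart (hproj x), hT.apply_image_base] using this
    rw [hA, hφ, zero_smul, zero_smul, sub_zero, zero_add] at hx
    exact hT.affineChart_eq_zero hφ hx
  have hAT : ∀ x, ∃ c : ℝ, A x = c • T x := by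
    intro x
    by_cases hφ : φ x = 0
    · obtain ⟨a, ha⟩ := hT.exists_affineChart_eq_smul hφ
      exact ⟨a, by simp [hA, hφ, ha]⟩
    · have hx : (φ x)⁻¹ • x = x₀ + (φ x)⁻¹ • (x - φ x • x₀) := by
        rw [smul_sub, inv_smul_smul₀ hφ]; abel
      obtain ⟨d, hd⟩ := mem_span_singleton.1 <| (hT.mem_span_singleton_iff x ((φ x)⁻¹ • x)).1 <|
        smul_mem _ _ (mem_span_singleton_self _)
      have hS : affineChart T ψ x₀ (x - φ x • x₀) =
          φ x • affineChart T ψ x₀ ((φ x)⁻¹ • (x - φ x • x₀)) := by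
        rw [hT.affineChart_smul (hproj x), smul_inv_smul₀ hφ]
      refine ⟨φ x * (ψ (T ((φ x)⁻¹ • x)))⁻¹ * d, ?_⟩
      rw [hA, hS, affineChart, ← hx, mul_smul, hd]
      module
  refine ⟨LinearEquiv.ofBijective A
    ⟨(injective_iff_map_eq_zero A).2 hA0, fun y => ?_⟩, hAT⟩
  obtain ⟨x, rfl⟩ := hT.surjective y
  obtain ⟨c, hc⟩ := hAT x
  rcases eq_or_ne c 0 with rfl | hc0
  · have : x = 0 := hA0 x (by simpa using hc)
    exact ⟨0, by simp [this, hT.map_zero]⟩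
  · exact ⟨c⁻¹ • x, by rw [map_smul, hc, inv_smul_smul₀ hc0]⟩

end HyperplaneCollineation
end Collineation

section BirkhoffJames

variable {X Y : Type*} [NormedAddCommGroup X] [NormedSpace ℝ X]
  [NormedAddCommGroup Y] [NormedSpace ℝ Y]

theorem BJOrth.zero_left (y : X) : BJOrth 0 y := fun l => by simp

theorem bjOrth_self_iff {x : X} : BJOrth x x ↔ x = 0 := by
  refine ⟨fun h => ?_, fun h => h ▸ BJOrth.zero_left _⟩
  simpa using h (-1)

theorem bjOrth_of_apply_eq_zero {x y : X} {f : X →L[ℝ] ℝ} (hf : ‖f‖ ≤ 1) (hx : f x = ‖x‖)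
    (hy : f y = 0) : BJOrth x y := fun l => by
  have h := (le_abs_self _).trans (f.le_of_opNorm_le hf (x + l • y))
  simpa [hx, hy] using h

theorem BJOrth.smul_left {x y : X} (h : BJOrth x y) (c : ℝ) : BJOrth (c • x) y := fun l => by
  rcases eq_or_ne c 0 with rfl | hc
  · simp
  · have := mul_le_mul_of_nonneg_left (h (c⁻¹ * l)) (norm_nonneg c)
    rwa [← norm_smul, ← norm_smul, smul_add, smul_smul, mul_inv_cancel_left₀ hc] at this

theorem BJOrth.smul_right {x y : X} (h : BJOrth x y) (c : ℝ) : BJOrth x (c • y) := fun l => by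
  simpa [smul_smul] using h (l * c)

/-- James' characterisation of Birkhoff–James orthogonality. -/
theorem BJOrth.exists_dual {x y : X} (h : BJOrth x y) :
    ∃ f : X →L[ℝ] ℝ, ‖f‖ ≤ 1 ∧ f x = ‖x‖ ∧ f y = 0 := by
  let S : Submodule ℝ X := span ℝ {y}
  have : IsClosed (S : Set X) := S.closed_of_finiteDimensional
  obtain ⟨g, hg, hgx⟩ := exists_dual_vector'' ℝ (S.mkQ x)
  let q : X →L[ℝ] X ⧸ S := S.mkQ.mkContinuous 1 fun z => by
    simpa using Submodule.Quotient.norm_mk_le S z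
  have hnorm : ‖S.mkQ x‖ = ‖x‖ := by
    refine le_antisymm (Submodule.Quotient.norm_mk_le S x) (le_of_forall_pos_le_add fun ε hε => ?_)
    obtain ⟨m, hm, hlt⟩ := Submodule.Quotient.norm_mk_lt (S.mkQ x) hε
    obtain ⟨l, hl⟩ := mem_span_singleton.1 ((Submodule.Quotient.eq S).1 hm)
    have := h l
    rw [hl, add_sub_cancel] at this
    exact this.trans hlt.le
  refine ⟨g.comp q, ?_, ?_, ?_⟩
  · calc ‖g.comp q‖ ≤ ‖g‖ * ‖q‖ := g.opNorm_comp_le q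
      _ ≤ 1 * 1 := by
        gcongr
        exact LinearMap.mkContinuous_norm_le _ zero_le_one _
      _ = 1 := one_mul 1
  · exact hgx.trans hnorm
  · have : q y = 0 := (Submodule.Quotient.mk_eq_zero S).2 (mem_span_singleton_self y)
    simp [this]

theorem SmoothSpace.exists_dual (hX : SmoothSpace X) {x : X} (hx : x ≠ 0) :
    ∃ f : X →L[ℝ] ℝ, ‖f‖ ≤ 1 ∧ f x = ‖x‖ ∧ ∀ y, BJOrth x y ↔ f y = 0 := by
  obtain ⟨f, hf⟩ := hX x hx
  have hmem : ‖f‖ ≤ 1 ∧ f x = ‖x‖ := hf.symm.subset rfl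
  refine ⟨f, hmem.1, hmem.2, fun y => ⟨fun h => ?_, bjOrth_of_apply_eq_zero hmem.1 hmem.2⟩⟩
  obtain ⟨g, hg, hgx, hgy⟩ := h.exists_dual
  obtain rfl : g = f := hf.subset ⟨hg, hgx⟩
  exact hgy

theorem Submodule.exists_norm_sub_le (S : Submodule ℝ X) [FiniteDimensional ℝ S] (z : X) :
    ∃ p : S, ∀ q : S, ‖z - p‖ ≤ ‖z - q‖ := by
  have : ProperSpace S := FiniteDimensional.proper ℝ S
  refine Continuous.exists_forall_le (f := fun p : S => ‖z - p‖) (by fun_prop) ?_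
  refine Filter.tendsto_atTop_mono (fun p : S => ?_)
    (Filter.tendsto_atTop_add_const_right _ (-‖z‖) (tendsto_norm_cocompact_atTop (E := S)))
  have := norm_sub_norm_le (p : X) z
  rw [norm_sub_rev] at this
  simpa using this

theorem SmoothSpace.mem_span_pair_iff (hX : SmoothSpace X) (x y z : X) :
    z ∈ span ℝ {x, y} ↔ ∀ u : X, BJOrth u x → BJOrth u y → BJOrth u z := by
  constructor
  · intro hz u hux huy
    rcases eq_or_ne u 0 with rfl | hu
    · exact BJOrth.zero_left z
    obtain ⟨f, -, -, hf⟩ := hX.exists_dual hu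
    obtain ⟨a, b, rfl⟩ := mem_span_pair.1 hz
    rw [hf] at *
    simp [hux, huy]
  · intro h
    have : FiniteDimensional ℝ (span ℝ {x, y}) :=
      FiniteDimensional.span_of_finite ℝ (Set.toFinite _)
    obtain ⟨p, hp⟩ := (span ℝ {x, y}).exists_norm_sub_le z
    have horth : ∀ w ∈ span ℝ {x, y}, BJOrth (z - p) w := fun w hw l => by
      have := hp (p - l • ⟨w, hw⟩)
      rwa [show z - ((p - l • ⟨w, hw⟩ : span ℝ {x, y}) : X) = z - p + l • w by
        push_cast; abel] at this
    have hz := h (z - p) (horth x (mem_span_of_mem (by simp))) (horth y (mem_span_of_mem (by simp)))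
    have hzp : z - p = 0 := by
      by_contra hne
      obtain ⟨f, -, hfz, hf⟩ := hX.exists_dual hne
      have hfp : f p = 0 := (hf p).1 (horth p p.2)
      rw [map_sub, (hf z).1 hz, hfp, sub_zero] at hfz
      exact hne (norm_eq_zero.1 hfz.symm)
    rw [sub_eq_zero.1 hzp]
    exact p.2

/-- A Birkhoff–James orthogonality preserver between smooth spaces, from a space of dimension at
least three, is projectively equal to a linear equivalence. -/
theorem SmoothSpace.exists_linearEquiv_of_bjOrth_iff [Nontrivial X] (hX : SmoothSpace X)
    (hY : SmoothSpace Y) (hdim : 3 ≤ Module.rank ℝ X) {T : X → Y} (hT : Function.Surjective T)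
    (hTorth : ∀ x y, BJOrth x y ↔ BJOrth (T x) (T y)) :
    ∃ A : X ≃ₗ[ℝ] Y, ∀ x, ∃ c : ℝ, A x = c • T x := by
  obtain ⟨x₀, hx₀⟩ := exists_ne (0 : X)
  have hTx₀ : T x₀ ≠ 0 := fun h => hx₀ <| by
    rwa [← bjOrth_self_iff, ← hTorth, bjOrth_self_iff] at h
  obtain ⟨f, -, hfx, hf⟩ := hX.exists_dual hx₀
  obtain ⟨g, -, hgx, hg⟩ := hY.exists_dual hTx₀
  have hxn := norm_ne_zero_iff.2 hx₀
  have hTxn := norm_ne_zero_iff.2 hTx₀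
  have hbase : (‖x₀‖⁻¹ • (f : X →ₗ[ℝ] ℝ)) x₀ = 1 := by simp [hfx, hxn]
  refine HyperplaneCollineation.exists_linearEquiv (φ := ‖x₀‖⁻¹ • (f : X →ₗ[ℝ] ℝ))
    (ψ := ‖T x₀‖⁻¹ • (g : Y →ₗ[ℝ] ℝ)) (x₀ := x₀) ⟨hT, ?_, ?_, hbase, ?_, ?_⟩
  · intro x y z
    rw [hX.mem_span_pair_iff, hY.mem_span_pair_iff, hT.forall]
    simp only [hTorth]
  · intro x
    simp [hxn, hTxn, ← hf, ← hg, hTorth]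
  · simp [hgx, hTxn]
  · intro h
    classical
    by_contra! hcon
    set φ := ‖x₀‖⁻¹ • (f : X →ₗ[ℝ] ℝ)
    have htop : span ℝ (({x₀, h} : Finset X) : Set X) = ⊤ := by
      refine eq_top_iff.2 fun x _ => ?_
      have hx := hcon (x - φ x • x₀) (by rw [map_sub, map_smul, hbase]; simp)
      obtain ⟨c, hc⟩ := mem_span_singleton.1 hx
      rw [Finset.coe_pair]
      exact mem_span_pair.2 ⟨φ x, c, by rw [hc]; abel⟩
    have hle := rank_span_finset_le (R := ℝ) ({x₀, h} : Finset X)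
    rw [htop, rank_top] at hle
    have h32 : (3 : Cardinal) ≤ 2 :=
      (hdim.trans hle).trans (by exact_mod_cast Finset.card_le_two)
    norm_num at h32

theorem eq_of_abs_sub_le_mul_sub {r d : ℝ → ℝ} {C : ℝ}
    (h : ∀ s ∈ Set.Icc (0 : ℝ) 1, ∀ t ∈ Set.Icc (0 : ℝ) 1,
      |r t - r s| ≤ C * ((t - s) * (d t - d s))) : r 1 = r 0 := by
  have key : ∀ n : ℕ, 0 < n → n * |r 1 - r 0| ≤ C * (d 1 - d 0) := by
    intro n hn
    have hn' : (0 : ℝ) < n := Nat.cast_pos.2 hn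
    have hi : ∀ i : ℕ, i ≤ n → n * |r (i / n) - r 0| ≤ C * (d (i / n) - d 0) := by
      intro i
      induction i with
      | zero => simp
      | succ i ih =>
        intro hin
        have h1 := ih (by omega)
        have hin' : ((i + 1 : ℕ) : ℝ) ≤ n := by exact_mod_cast hin
        push_cast at hin' ⊢
        have h2 := h (i / n) ⟨by positivity, by rw [div_le_one hn']; linarith⟩
          ((i + 1) / n) ⟨by positivity, by rwa [div_le_one hn']⟩
        have h3 : ((i : ℝ) + 1) / n - i / n = (n : ℝ)⁻¹ := by field_simp; ring
        rw [h3, mul_left_comm, ← div_eq_inv_mul, le_div_iff₀' hn'] at h2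
        have h4 := mul_le_mul_of_nonneg_left
          (abs_sub_le (r ((i + 1) / n)) (r (i / n)) (r 0)) hn'.le
        linarith
    simpa [hn'.ne'] using hi n le_rfl
  by_contra hne
  have hpos : 0 < |r 1 - r 0| := abs_pos.2 (sub_ne_zero.2 hne)
  obtain ⟨n, hn⟩ := exists_nat_gt (C * (d 1 - d 0) / |r 1 - r 0|)
  rw [div_lt_iff₀ hpos] at hn
  have h1 := key (n + 1) n.succ_pos
  push_cast at h1
  linarith

theorem SmoothSpace.exists_dual_norm_mul_le (hX : SmoothSpace X) (hY : SmoothSpace Y)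
    {A : X ≃ₗ[ℝ] Y} (hA : ∀ x y, BJOrth x y ↔ BJOrth (A x) (A y)) {u : X} (hu : u ≠ 0) :
    ∃ f : X →L[ℝ] ℝ, f u = ‖u‖ ∧ (∀ v, f v ≤ ‖v‖) ∧ ∀ v, ‖A u‖ / ‖u‖ * f v ≤ ‖A v‖ := by
  obtain ⟨f, hf1, hfu, hf⟩ := hX.exists_dual hu
  obtain ⟨g, hg1, hgu, hg⟩ := hY.exists_dual (x := A u) (by simpa using hu)
  have hun := norm_ne_zero_iff.2 hu
  refine ⟨f, hfu, fun v => ?_, fun v => ?_⟩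
  · simpa using (le_abs_self _).trans (f.le_of_opNorm_le hf1 v)
  · have h1 : g (A (v - (f v / ‖u‖) • u)) = 0 := by
      rw [← hg, ← hA, hf]
      simp [hfu, hun]
    rw [map_sub, map_sub, map_smul, map_smul, hgu, sub_eq_zero, smul_eq_mul] at h1
    have h2 := (le_abs_self _).trans (g.le_of_opNorm_le hg1 (A v))
    rw [h1, one_mul] at h2
    calc ‖A u‖ / ‖u‖ * f v = f v / ‖u‖ * ‖A u‖ := by ring
      _ ≤ ‖A v‖ := h2

theorem SmoothSpace.norm_div_norm_eq_of_segment (hX : SmoothSpace X) (hY : SmoothSpace Y)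
    {A : X ≃ₗ[ℝ] Y} (hA : ∀ x y, BJOrth x y ↔ BJOrth (A x) (A y)) {x y : X}
    (hxy : ∀ t : ℝ, x + t • y ≠ 0) : ‖A (x + y)‖ / ‖x + y‖ = ‖A x‖ / ‖x‖ := by
  choose f hf hfle hAf using fun t => hX.exists_dual_norm_mul_le hY hA (hxy t)
  let ρ : ℝ → ℝ := fun t => ‖A (x + t • y)‖ / ‖x + t • y‖
  have hpos : ∀ t, 0 < ‖x + t • y‖ := fun t => norm_pos_iff.2 (hxy t)
  obtain ⟨t₀, -, ht₀⟩ := isCompact_Icc.exists_isMinOn (Set.nonempty_Icc.2 zero_le_one)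
    (f := fun t : ℝ => ‖x + t • y‖) (s := Set.Icc (0 : ℝ) 1) (by fun_prop)
  set m := ‖x + t₀ • y‖
  have hm : 0 < m := hpos t₀
  let M := (‖A x‖ + ‖A y‖) / m
  have hM : 0 ≤ M := by positivity
  have hρM : ∀ t ∈ Set.Icc (0 : ℝ) 1, ρ t ≤ M := by
    intro t ht
    have h1 : ‖A (x + t • y)‖ ≤ ‖A x‖ + ‖A y‖ := by
      rw [map_add, map_smul]
      refine (norm_add_le _ _).trans ?_
      rw [norm_smul, Real.norm_of_nonneg ht.1]
      gcongr
      exact mul_le_of_le_one_left (norm_nonneg _) ht.2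
    exact div_le_div₀ (by positivity) h1 hm (ht₀ ht)
  have hfs : ∀ s t, f t (x + s • y) = ‖x + t • y‖ + (s - t) * f t y := by
    intro s t
    rw [← hf t]
    simp only [map_add, map_smul, smul_eq_mul]
    ring
  have hmono : ∀ s t, 0 ≤ (t - s) * (f t y - f s y) := by
    intro s t
    have h1 := hfle t (x + s • y)
    have h2 := hfle s (x + t • y)
    rw [hfs] at h1 h2
    linarith
  have hle : ∀ s ∈ Set.Icc (0 : ℝ) 1, ∀ t ∈ Set.Icc (0 : ℝ) 1,
      ρ t - ρ s ≤ M / m * ((t - s) * (f t y - f s y)) := by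
    intro s hs t ht
    have h1 := hAf t (x + s • y)
    have h2 := hfle s (x + t • y)
    rw [hfs] at h1 h2
    have hAs : ‖A (x + s • y)‖ = ρ s * ‖x + s • y‖ := (div_mul_cancel₀ _ (hpos s).ne').symm
    rw [hAs] at h1
    change ρ t * _ ≤ _ at h1
    have hρt : 0 ≤ ρ t := by positivity
    have h3 : (ρ t - ρ s) * ‖x + s • y‖ ≤ M * ((t - s) * (f t y - f s y)) := by
      have h4 := mul_le_mul_of_nonneg_left h2 hρt
      have h5 := mul_le_mul_of_nonneg_right (hρM t ht) (hmono s t)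
      linarith
    rw [div_mul_eq_mul_div, le_div_iff₀ hm]
    rcases le_total 0 (ρ t - ρ s) with h0 | h0
    · exact (mul_le_mul_of_nonneg_left (ht₀ hs) h0).trans h3
    · exact (mul_nonpos_of_nonpos_of_nonneg h0 hm.le).trans (mul_nonneg hM (hmono s t))
  have h10 : ρ 1 = ρ 0 := eq_of_abs_sub_le_mul_sub (d := fun t => f t y) (C := M / m)
    fun s hs t ht => abs_sub_le_iff.2 ⟨hle s hs t ht, (hle t ht s hs).trans_eq (by ring)⟩
  simpa [ρ] using h10

/-- A linear Birkhoff–James orthogonality preserver between smooth spaces is a scalar multiple of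
an isometry. -/
theorem SmoothSpace.nonempty_linearIsometryEquiv (hX : SmoothSpace X) (hY : SmoothSpace Y)
    [Nontrivial X] (A : X ≃ₗ[ℝ] Y) (hA : ∀ x y, BJOrth x y ↔ BJOrth (A x) (A y)) :
    Nonempty (X ≃ₗᵢ[ℝ] Y) := by
  obtain ⟨x₀, hx₀⟩ := exists_ne (0 : X)
  have hx₀n := norm_pos_iff.2 hx₀
  have hAx₀n : 0 < ‖A x₀‖ := norm_pos_iff.2 (by simpa using hx₀)
  have hnorm : ∀ x, ‖A x‖ = ‖A x₀‖ / ‖x₀‖ * ‖x‖ := by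
    intro x
    by_cases hx : x ∈ span ℝ {x₀}
    · obtain ⟨c, rfl⟩ := mem_span_singleton.1 hx
      rw [map_smul, norm_smul, norm_smul]
      field_simp
    · have hline : ∀ t : ℝ, x₀ + t • (x - x₀) ≠ 0 := by
        intro t ht
        rcases eq_or_ne t 0 with rfl | ht0
        · exact hx₀ (by simpa using ht)
        · refine hx (mem_span_singleton.2 ⟨t⁻¹ * (t - 1), ?_⟩)
          rw [mul_smul, inv_smul_eq_iff₀ ht0]
          linear_combination (norm := module) -ht
      have h := hX.norm_div_norm_eq_of_segment hY hA hline
      rw [add_sub_cancel] at h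
      have hxn : ‖x‖ ≠ 0 := norm_ne_zero_iff.2 fun h0 => hx (h0 ▸ zero_mem _)
      rw [← h, div_mul_cancel₀ _ hxn]
  have hc : ‖x₀‖ / ‖A x₀‖ ≠ 0 := by positivity
  refine ⟨⟨A.trans (LinearEquiv.smulOfNeZero ℝ Y _ hc), fun x => ?_⟩⟩
  change ‖(‖x₀‖ / ‖A x₀‖) • A x‖ = ‖x‖
  rw [norm_smul, hnorm x, Real.norm_of_nonneg (by positivity)]
  field_simp

theorem SmoothSpace.nonempty_linearIsometryEquiv_of_bjOrth_iff (hX : SmoothSpace X)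
    (hY : SmoothSpace Y) (hdim : 3 ≤ Module.rank ℝ X) {T : X → Y} (hT : Function.Surjective T)
    (hTorth : ∀ x y, BJOrth x y ↔ BJOrth (T x) (T y)) : Nonempty (X ≃ₗᵢ[ℝ] Y) := by
  have : Nontrivial X := by
    refine (rank_pos_iff_nontrivial (R := ℝ)).1 (lt_of_lt_of_le ?_ hdim)
    norm_num
  obtain ⟨A, hAT⟩ := hX.exists_linearEquiv_of_bjOrth_iff hY hdim hT hTorth
  have hT0 : T 0 = 0 := bjOrth_self_iff.1 ((hTorth 0 0).1 (BJOrth.zero_left 0))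
  have hTA : ∀ x, ∃ c : ℝ, T x = c • A x := by
    intro x
    obtain ⟨c, hc⟩ := hAT x
    rcases eq_or_ne c 0 with rfl | hc0
    · have : x = 0 := by simpa using hc
      exact ⟨0, by simp [this, hT0]⟩
    · exact ⟨c⁻¹, by rw [hc, inv_smul_smul₀ hc0]⟩
  refine hX.nonempty_linearIsometryEquiv hY A fun x y => ?_
  obtain ⟨a, ha⟩ := hAT x
  obtain ⟨b, hb⟩ := hAT y
  obtain ⟨a', ha'⟩ := hTA x
  obtain ⟨b', hb'⟩ := hTA y
  rw [hTorth]
  constructor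
  · intro h
    rw [ha, hb]
    exact (h.smul_left a).smul_right b
  · intro h
    rw [ha', hb']
    exact (h.smul_left a').smul_right b'

end BirkhoffJames

/-- Smooth Banach spaces of dimension at least three admit a Birkhoff–James orthogonality
preserver between them if and only if they are isometrically isomorphic. -/
theorem smooth_bj_equiv_iff_isometric
    {X Y : Type*} [NormedAddCommGroup X] [NormedSpace ℝ X] [CompleteSpace X]
    [NormedAddCommGroup Y] [NormedSpace ℝ Y] [CompleteSpace Y]
    (hX : SmoothSpace X) (hY : SmoothSpace Y)
    (hdim : 3 ≤ Module.rank ℝ X ∨ 3 ≤ Module.rank ℝ Y) :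
    (∃ T : X → Y, Function.Bijective T ∧
        ∀ x y : X, BJOrth x y ↔ BJOrth (T x) (T y)) ↔
      Nonempty (X ≃ₗᵢ[ℝ] Y) := by
  constructor
  · rintro ⟨T, hT, hTorth⟩
    rcases hdim with hdim | hdim
    · exact hX.nonempty_linearIsometryEquiv_of_bjOrth_iff hY hdim hT.surjective hTorth
    · let e := Equiv.ofBijective T hT
      have he : ∀ y, T (e.symm y) = y := e.apply_symm_apply
      obtain ⟨f⟩ := hY.nonempty_linearIsometryEquiv_of_bjOrth_iff hX hdim e.symm.surjective
        fun x y => by rw [hTorth, he, he]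
      exact ⟨f.symm⟩
  · rintro ⟨e⟩
    refine ⟨e, e.bijective, fun x y => forall_congr' fun l => ?_⟩
    rw [← map_smul, ← map_add, e.norm_map, e.norm_map]
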